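/- Let R be an η-symmetric linear operator on ℝ^5. Then there exists a semi-null pentad (l, m, x, y, z) and real numbers ρ1, ρ2, ρ3, ρ4, ρ5 such that the associated bilinear form B(u,v) := η(R u, v) is given by exactly one of the following four canonical forms (for all u, v): (i) B(u,v) = ρ1(η(l,u)η(m,v)+η(m,u)η(l,v)) + ρ2(η(l,u)η(l,v)+η(m,u)η(m,v)) + ρ3 η(x,u)η(x,v) + ρ4 η(y,u)η(y,v) + ρ5 η(z,u)η(z,v); (ii) B(u,v) = ρ1(η(l,u)η(m,v)+η(m,u)η(l,v)) + ε η(l,u)η(l,v) + ρ3 η(x,u)η(x,v) + ρ4 η(y,u)η(y,v) + ρ5 η(z,u)η(z,v) with ε = 1 or ε = -1; (iii) B(u,v) = ρ1(η(l,u)η(m,v)+η(m,u)η(l,v)) + (η(l,u)η(x,v)+η(x,u)η(l,v)) + ρ1 η(x,u)η(x,v) + ρ4 η(y,u)η(y,v) + ρ5 η(z,u)η(z,v); (iv) B(u,v) = ρ1(η(l,u)η(m,v)+η(m,u)η(l,v)) + ρ2(η(l,u)η(l,v) - η(m,u)η(m,v)) + ρ3 η(x,u)η(x,v) + ρ4 η(y,u)η(y,v)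 + ρ5 η(z,u)η(z,v) with ρ2 ≠ 0. -/

import Mathlib

/-- The 5-dimensional Minkowski bilinear form of signature (-,+,+,+,+). -/
def eta (u v : Fin 5 → ℝ) : ℝ :=
  -u 0 * v 0 + u 1 * v 1 + u 2 * v 2 + u 3 * v 3 + u 4 * v 4

/-- A semi-null pentad: η(l,m) = η(x,x) = η(y,y) = η(z,z) = 1 and all other
pairwise inner products among l, m, x, y, z vanish. -/
def SemiNullPentad (l m x y z : Fin 5 → ℝ) : Prop :=
  eta l m = 1 ∧ eta x x = 1 ∧ eta y y = 1 ∧ eta z z = 1 ∧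
  eta l l = 0 ∧ eta m m = 0 ∧
  eta l x = 0 ∧ eta l y = 0 ∧ eta l z = 0 ∧
  eta m x = 0 ∧ eta m y = 0 ∧ eta m z = 0 ∧
  eta x y = 0 ∧ eta x z = 0 ∧ eta y z = 0

/-- Canonical form (i), Segre type [1,1111]. -/
def Form1 (R : (Fin 5 → ℝ) →ₗ[ℝ] (Fin 5 → ℝ)) (l m x y z : Fin 5 → ℝ)
    (p1 p2 p3 p4 p5 : ℝ) : Prop :=
  ∀ u v : Fin 5 → ℝ, eta (R u) v =
    p1 * (eta l u * eta m v + eta m u * eta l v) +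
    p2 * (eta l u * eta l v + eta m u * eta m v) +
    p3 * (eta x u * eta x v) + p4 * (eta y u * eta y v) + p5 * (eta z u * eta z v)

/-- Canonical form (ii), Segre type [2111]. -/
def Form2 (R : (Fin 5 → ℝ) →ₗ[ℝ] (Fin 5 → ℝ)) (l m x y z : Fin 5 → ℝ)
    (p1 p3 p4 p5 : ℝ) : Prop :=
  ∃ ε : ℝ, (ε = 1 ∨ ε = -1) ∧ ∀ u v : Fin 5 → ℝ, eta (R u) v =
    p1 * (eta l u * eta m v + eta m u * eta l v) +
    ε * (eta l u * eta l v) +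
    p3 * (eta x u * eta x v) + p4 * (eta y u * eta y v) + p5 * (eta z u * eta z v)

/-- Canonical form (iii), Segre type [311]. -/
def Form3 (R : (Fin 5 → ℝ) →ₗ[ℝ] (Fin 5 → ℝ)) (l m x y z : Fin 5 → ℝ)
    (p1 p4 p5 : ℝ) : Prop :=
  ∀ u v : Fin 5 → ℝ, eta (R u) v =
    p1 * (eta l u * eta m v + eta m u * eta l v) +
    (eta l u * eta x v + eta x u * eta l v) +
    p1 * (eta x u * eta x v) + p4 * (eta y u * eta y v) + p5 * (eta z u * eta z v)

/-- Canonical form (iv), Segre type [z z̄ 111]. -/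
def Form4 (R : (Fin 5 → ℝ) →ₗ[ℝ] (Fin 5 → ℝ)) (l m x y z : Fin 5 → ℝ)
    (p1 p2 p3 p4 p5 : ℝ) : Prop :=
  p2 ≠ 0 ∧ ∀ u v : Fin 5 → ℝ, eta (R u) v =
    p1 * (eta l u * eta m v + eta m u * eta l v) +
    p2 * (eta l u * eta l v - eta m u * eta m v) +
    p3 * (eta x u * eta x v) + p4 * (eta y u * eta y v) + p5 * (eta z u * eta z v)

set_option linter.unusedSimpArgs false


/-- Five-dimensional space. -/
abbrev V5 := Fin 5 → ℝ

theorem eta_comm (u v : V5) : eta u v = eta v u := by unfold eta; ring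
theorem eta_add_left (u v w : V5) : eta (u + v) w = eta u w + eta v w := by
  simp only [eta, Pi.add_apply]; ring
theorem eta_add_right (u v w : V5) : eta w (u + v) = eta w u + eta w v := by
  simp only [eta, Pi.add_apply]; ring
theorem eta_sub_left (u v w : V5) : eta (u - v) w = eta u w - eta v w := by
  simp only [eta, Pi.sub_apply]; ring
theorem eta_sub_right (u v w : V5) : eta w (u - v) = eta w u - eta w v := by
  simp only [eta, Pi.sub_apply]; ring
theorem eta_smul_left (c : ℝ) (u w : V5) : eta (c • u) w = c * eta u w := by
  simp only [eta, Pi.smul_apply, smul_eq_mul]; ring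
theorem eta_smul_right (c : ℝ) (u w : V5) : eta w (c • u) = c * eta w u := by
  simp only [eta, Pi.smul_apply, smul_eq_mul]; ring

/-- The Minkowski form as a bilinear map. -/
noncomputable def etaB : V5 →ₗ[ℝ] V5 →ₗ[ℝ] ℝ :=
  LinearMap.mk₂ ℝ eta eta_add_left eta_smul_left (fun w u v => eta_add_right u v w)
    (fun c w u => eta_smul_right c u w)

theorem etaB_apply (u v : V5) : etaB u v = eta u v := rfl

/-- Simultaneous diagonalisation of a positive definite and a symmetric form. -/
theorem diag_abstract {E : Type*} [AddCommGroup E] [Module ℝ E] [FiniteDimensional ℝ E]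
    (g B : E →ₗ[ℝ] E →ₗ[ℝ] ℝ) (hg : ∀ u v, g u v = g v u) (hB : ∀ u v, B u v = B v u)
    (hpos : ∀ u, u ≠ 0 → 0 < g u u) (n : ℕ) (hn : Module.finrank ℝ E = n) :
    ∃ (x : Fin n → E) (r : Fin n → ℝ), (∀ i j, g (x i) (x j) = if i = j then 1 else 0) ∧
      (∀ i j, B (x i) (x j) = if i = j then r i else 0) ∧
      ∀ s, s = ∑ i, g (x i) s • x i := by
  have hnn : ∀ u, 0 ≤ g u u := fun u => by
    by_cases h : u = 0
    · simp [h]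
    · exact (hpos u h).le
  let core : InnerProductSpace.Core ℝ E :=
    { inner := fun u v => g u v
      conj_inner_symm := fun u v => by simpa using hg v u
      re_inner_nonneg := fun u => by simpa using hnn u
      add_left := fun u v w => by simp
      smul_left := fun u v c => by simp
      definite := fun u h => by
        by_contra hu
        exact (hpos u hu).ne' h }
  let _ : NormedAddCommGroup E := core.toNormedAddCommGroup
  let _ : InnerProductSpace ℝ E := InnerProductSpace.ofCore core.toCore
  have hin : ∀ u v : E, inner ℝ u v = g u v := fun u v => rfl
  let b := stdOrthonormalBasis ℝ E
  let T : E →ₗ[ℝ] E := ∑ i, (B.flip (b i)).smulRight (b i)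
  have hT : ∀ u v, inner ℝ (T u) v = B u v := by
    intro u v
    have h1 : T u = ∑ i, B u (b i) • b i := by simp [T]
    rw [h1, sum_inner]
    conv_rhs => rw [← b.sum_repr' v]
    rw [map_sum]
    refine Finset.sum_congr rfl fun i _ => ?_
    rw [real_inner_smul_left, map_smul, smul_eq_mul, mul_comm]
  have hTs : T.IsSymmetric := by
    intro u v
    rw [hT, real_inner_comm, hT, hB]
  let e := hTs.eigenvectorBasis hn
  refine ⟨e, hTs.eigenvalues hn, ?_, ?_, ?_⟩
  · intro i j
    rw [← hin]
    exact orthonormal_iff_ite.mp e.orthonormal i j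
  · intro i j
    rw [← hT]
    have h2 := hTs.apply_eigenvectorBasis hn i
    have h3 : T (e i) = (hTs.eigenvalues hn i) • e i := h2
    rw [h3, real_inner_smul_left, orthonormal_iff_ite.mp e.orthonormal i j]
    simp
  · intro s
    exact (e.sum_repr' s).symm

theorem diag_sub (R : V5 →ₗ[ℝ] V5) (hR : ∀ u v : V5, eta (R u) v = eta u (R v))
    (S : Submodule ℝ V5) (hpos : ∀ s ∈ S, s ≠ 0 → 0 < eta s s) (n : ℕ)
    (hn : Module.finrank ℝ S = n) :
    ∃ (x : Fin n → V5) (r : Fin n → ℝ), (∀ i, x i ∈ S) ∧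
      (∀ i j, eta (x i) (x j) = if i = j then 1 else 0) ∧
      (∀ i j, eta (R (x i)) (x j) = if i = j then r i else 0) ∧
      ∀ s ∈ S, s = ∑ i, eta (x i) s • x i := by
  obtain ⟨x, r, h1, h2, h3⟩ := diag_abstract (E := S)
    (etaB.compl₁₂ S.subtype S.subtype) ((etaB.comp R).compl₁₂ S.subtype S.subtype)
    (fun u v => eta_comm _ _)
    (fun u v => by
      change eta (R u) v = eta (R v) u
      rw [hR, eta_comm])
    (fun u hu => hpos u u.2 (by simpa using hu)) n hn
  refine ⟨fun i => x i, r, fun i => (x i).2, h1, h2, ?_⟩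
  intro s hs
  have := congrArg S.subtype (h3 ⟨s, hs⟩)
  simp only [map_sum, map_smul] at this
  exact this

theorem zero_of_spatial (u : V5) (h0 : u 0 = 0) (h : eta u u ≤ 0) : u = 0 := by
  simp only [eta, h0] at h
  have p1 := mul_self_nonneg (u 1)
  have p2 := mul_self_nonneg (u 2)
  have p3 := mul_self_nonneg (u 3)
  have p4 := mul_self_nonneg (u 4)
  have q1 : u 1 = 0 := mul_self_eq_zero.mp (by linarith)
  have q2 : u 2 = 0 := mul_self_eq_zero.mp (by linarith)
  have q3 : u 3 = 0 := mul_self_eq_zero.mp (by linarith)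
  have q4 : u 4 = 0 := mul_self_eq_zero.mp (by linarith)
  funext i
  fin_cases i <;> simp [h0, q1, q2, q3, q4]

theorem timelike_perp (t u : V5) (ht : eta t t < 0) (htu : eta t u = 0) (hu : u ≠ 0) :
    0 < eta u u := by
  by_contra hcon
  push Not at hcon
  refine hu (zero_of_spatial u ?_ hcon)
  simp only [eta] at *
  have e1 : t 0 * u 0 = t 1 * u 1 + t 2 * u 2 + t 3 * u 3 + t 4 * u 4 := by linarith
  have cs : (t 1 * u 1 + t 2 * u 2 + t 3 * u 3 + t 4 * u 4) ^ 2 ≤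
      (t 1 ^ 2 + t 2 ^ 2 + t 3 ^ 2 + t 4 ^ 2) * (u 1 ^ 2 + u 2 ^ 2 + u 3 ^ 2 + u 4 ^ 2) := by
    linarith [sq_nonneg (t 1 * u 2 - t 2 * u 1), sq_nonneg (t 1 * u 3 - t 3 * u 1),
      sq_nonneg (t 1 * u 4 - t 4 * u 1), sq_nonneg (t 2 * u 3 - t 3 * u 2),
      sq_nonneg (t 2 * u 4 - t 4 * u 2), sq_nonneg (t 3 * u 4 - t 4 * u 3)]
  rw [← e1] at cs
  have h2 : (t 1 ^ 2 + t 2 ^ 2 + t 3 ^ 2 + t 4 ^ 2) < t 0 ^ 2 := by linarith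
  have h3 : u 1 ^ 2 + u 2 ^ 2 + u 3 ^ 2 + u 4 ^ 2 ≤ u 0 ^ 2 := by linarith
  by_contra h0
  have h4 : 0 < u 0 ^ 2 := by positivity
  have h5 : (t 1 ^ 2 + t 2 ^ 2 + t 3 ^ 2 + t 4 ^ 2) * (u 1 ^ 2 + u 2 ^ 2 + u 3 ^ 2 + u 4 ^ 2)
      ≤ (t 1 ^ 2 + t 2 ^ 2 + t 3 ^ 2 + t 4 ^ 2) * u 0 ^ 2 :=
    mul_le_mul_of_nonneg_left h3 (by positivity)
  have h6 := mul_lt_mul_of_pos_right h2 h4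
  linarith [mul_pow (t 0) (u 0) 2]

theorem null_perp (u w : V5) (hu0 : u ≠ 0) (hu : eta u u = 0) (hw : eta w w = 0)
    (huw : eta u w = 0) : ∃ k : ℝ, w = k • u := by
  have h0 : u 0 ≠ 0 := fun h => hu0 (zero_of_spatial u h hu.le)
  refine ⟨w 0 / u 0, ?_⟩
  set k := w 0 / u 0 with hk
  have hz : (w - k • u) 0 = 0 := by simp [hk, h0]
  have hq : eta (w - k • u) (w - k • u) = 0 := by
    simp only [eta_sub_left, eta_sub_right, eta_smul_left, eta_smul_right, hw, hu, huw,
      eta_comm w u]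
    ring
  exact sub_eq_zero.mp (zero_of_spatial _ hz hq.le)

/-- The functional `η(t, ·)`. -/
theorem etaB_surj_one (t : V5) (ht : eta t t < 0) :
    Module.finrank ℝ (LinearMap.ker (etaB t)) = 4 := by
  have hs : Function.Surjective (etaB t) := by
    intro c
    refine ⟨(c / eta t t) • t, ?_⟩
    rw [map_smul, etaB_apply, smul_eq_mul]
    exact div_mul_cancel₀ c ht.ne
  have h := LinearMap.finrank_range_add_finrank_ker (etaB t)
  rw [LinearMap.range_eq_top.mpr hs] at h
  simp at h
  omega

theorem etaB_surj_two (l m : V5) (hlm : eta l m = 1) (hl : eta l l = 0) (hm : eta m m = 0) :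
    Module.finrank ℝ (LinearMap.ker ((etaB l).prod (etaB m))) = 3 := by
  have hml : eta m l = 1 := by rw [eta_comm, hlm]
  have hs : Function.Surjective ((etaB l).prod (etaB m)) := by
    rintro ⟨c, d⟩
    refine ⟨c • m + d • l, ?_⟩
    simp [etaB_apply, hlm, hl, hm, hml, eta_add_right, eta_sub_right, eta_smul_right]
  have h := LinearMap.finrank_range_add_finrank_ker ((etaB l).prod (etaB m))
  rw [LinearMap.range_eq_top.mpr hs] at h
  simp at h
  omega

theorem expand_key (R : V5 →ₗ[ℝ] V5) (hR : ∀ u v : V5, eta (R u) v = eta u (R v))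
    (l m x y z : V5) (a b c d e a' b' c' d' e' : ℝ)
    (hxy : eta (R x) y = 0) (hxz : eta (R x) z = 0) (hyz : eta (R y) z = 0) :
    eta (R (a • l + b • m + (c • x + d • y + e • z)))
      (a' • l + b' • m + (c' • x + d' • y + e' • z)) =
      eta (R l) l * (a * a') + eta (R l) m * (a * b' + b * a') + eta (R m) m * (b * b') +
      eta (R l) x * (a * c' + c * a') + eta (R l) y * (a * d' + d * a') +
      eta (R l) z * (a * e' + e * a') +
      eta (R m) x * (b * c' + c * b') + eta (R m) y * (b * d' + d * b') +
      eta (R m) z * (b * e' + e * b') +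
      eta (R x) x * (c * c') + eta (R y) y * (d * d') + eta (R z) z * (e * e') := by
  have s : ∀ p q : V5, eta (R p) q = eta (R q) p := fun p q => by rw [hR, eta_comm]
  simp only [map_add, map_smul, eta_add_left, eta_add_right, eta_smul_left, eta_smul_right]
  rw [s m l, s x l, s y l, s z l, s x m, s y m, s z m, s y x, s z x, s z y, hxy, hxz, hyz]
  ring

theorem extend_pair (R : V5 →ₗ[ℝ] V5) (hR : ∀ u v : V5, eta (R u) v = eta u (R v))
    (l m : V5) (hlm : eta l m = 1) (hl : eta l l = 0) (hm : eta m m = 0) :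
    ∃ x y z : V5, SemiNullPentad l m x y z ∧ ∀ u v : V5, eta (R u) v =
      eta (R l) l * (eta m u * eta m v) +
      eta (R l) m * (eta m u * eta l v + eta l u * eta m v) + eta (R m) m * (eta l u * eta l v) +
      eta (R l) x * (eta m u * eta x v + eta x u * eta m v) +
      eta (R l) y * (eta m u * eta y v + eta y u * eta m v) +
      eta (R l) z * (eta m u * eta z v + eta z u * eta m v) +
      eta (R m) x * (eta l u * eta x v + eta x u * eta l v) +
      eta (R m) y * (eta l u * eta y v + eta y u * eta l v) +
      eta (R m) z * (eta l u * eta z v + eta z u * eta l v) +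
      eta (R x) x * (eta x u * eta x v) + eta (R y) y * (eta y u * eta y v) +
      eta (R z) z * (eta z u * eta z v) := by
  have hml : eta m l = 1 := by rw [eta_comm, hlm]
  obtain ⟨x, r, hS, ho, hd, hs⟩ := diag_sub R hR (LinearMap.ker ((etaB l).prod (etaB m)))
    (fun s hs hs0 => by
      have h1 : eta l s = 0 ∧ eta m s = 0 := by simpa [etaB_apply] using hs
      refine timelike_perp (l - m) s ?_ ?_ hs0
      · simp only [eta_sub_left, eta_sub_right, hlm, hl, hm, hml]; norm_num
      · simp only [eta_sub_left, h1]; norm_num) 3 (etaB_surj_two l m hlm hl hm)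
  have hS' : ∀ i, eta l (x i) = 0 ∧ eta m (x i) = 0 := fun i => by
    simpa [etaB_apply] using hS i
  have hexp : ∀ u : V5, u = eta m u • l + eta l u • m +
      (eta (x 0) u • x 0 + eta (x 1) u • x 1 + eta (x 2) u • x 2) := by
    intro u
    have h := hs (u - (eta m u • l + eta l u • m)) (by
      simp [etaB_apply, hlm, hl, hm, hml, eta_add_right, eta_sub_right, eta_smul_right])
    have hz : ∀ i, eta (x i) (u - (eta m u • l + eta l u • m)) = eta (x i) u := fun i => by
      simp only [eta_sub_right, eta_add_right, eta_smul_right, eta_comm (x i) l,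
        eta_comm (x i) m, hS' i]
      ring
    simp only [hz, Fin.sum_univ_three] at h
    rw [← h]
    abel
  refine ⟨x 0, x 1, x 2, ⟨hlm, by simp [ho], by simp [ho], by simp [ho], hl, hm, (hS' 0).1,
    (hS' 1).1, (hS' 2).1, (hS' 0).2, (hS' 1).2, (hS' 2).2, by simp [ho], by simp [ho],
    by simp [ho]⟩, ?_⟩
  intro u v
  have h := expand_key R hR l m (x 0) (x 1) (x 2) (eta m u) (eta l u) (eta (x 0) u)
    (eta (x 1) u) (eta (x 2) u) (eta m v) (eta l v) (eta (x 0) v) (eta (x 1) v) (eta (x 2) v)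
    (by simp [hd]) (by simp [hd]) (by simp [hd])
  rw [← hexp u, ← hexp v] at h
  exact h

/-- Existence of one of the four forms. -/
def HasForm (R : V5 →ₗ[ℝ] V5) : Prop :=
  ∃ l m x y z : V5, SemiNullPentad l m x y z ∧ ∃ p1 p2 p3 p4 p5 : ℝ,
    Form1 R l m x y z p1 p2 p3 p4 p5 ∨ Form2 R l m x y z p1 p3 p4 p5 ∨
    Form3 R l m x y z p1 p4 p5 ∨ Form4 R l m x y z p1 p2 p3 p4 p5

theorem timelike_case (R : V5 →ₗ[ℝ] V5) (hR : ∀ u v : V5, eta (R u) v = eta u (R v))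
    (t : V5) (μ : ℝ) (ht : eta t t < 0) (hRt : R t = μ • t) : HasForm R := by
  wlog h1 : eta t t = -1 generalizing t with H
  · have hs : 0 < √(-eta t t) := Real.sqrt_pos.mpr (by linarith)
    have hq : √(-eta t t) * √(-eta t t) = -eta t t := Real.mul_self_sqrt (by linarith)
    have hn : eta ((√(-eta t t))⁻¹ • t) ((√(-eta t t))⁻¹ • t) = -1 := by
      simp only [eta_smul_left, eta_smul_right]
      field_simp
      rw [pow_two, hq]; ring
    exact H ((√(-eta t t))⁻¹ • t) (by rw [hn]; norm_num)
      (by rw [map_smul, hRt, smul_comm]) hn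
  obtain ⟨x, r, hS, ho, hd, hs⟩ := diag_sub R hR (LinearMap.ker (etaB t))
    (fun s hs hs0 => timelike_perp t s ht (by simpa [etaB_apply] using hs) hs0) 4
    (etaB_surj_one t ht)
  have hS' : ∀ i, eta t (x i) = 0 := fun i => by simpa [etaB_apply] using hS i
  have hS'' : ∀ i, eta (x i) t = 0 := fun i => by rw [eta_comm, hS' i]
  have hexp : ∀ u : V5, u = (-eta t u) • t +
      (eta (x 0) u • x 0 + eta (x 1) u • x 1 + eta (x 2) u • x 2 + eta (x 3) u • x 3) := by
    intro u
    have h := hs (u + eta t u • t) (by simp [etaB_apply, h1, eta_add_right, eta_sub_right, eta_smul_right])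
    have hz : ∀ i, eta (x i) (u + eta t u • t) = eta (x i) u := fun i => by
      simp only [eta_add_right, eta_smul_right, hS'']
      ring
    simp only [hz, Fin.sum_univ_four] at h
    rw [← h]
    simp
  have hB : ∀ u v : V5, eta (R u) v = -μ * (eta t u * eta t v) + r 0 * (eta (x 0) u * eta (x 0) v)
      + r 1 * (eta (x 1) u * eta (x 1) v) + r 2 * (eta (x 2) u * eta (x 2) v)
      + r 3 * (eta (x 3) u * eta (x 3) v) := by
    have hxt : ∀ i, eta (R (x i)) t = 0 := fun i => by
      rw [hR, hRt, eta_smul_right, hS'', mul_zero]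
    have key : ∀ a b c d e a' b' c' d' e' : ℝ,
        eta (R ((-a) • t + (b • x 0 + c • x 1 + d • x 2 + e • x 3)))
          ((-a') • t + (b' • x 0 + c' • x 1 + d' • x 2 + e' • x 3)) =
        -μ * (a * a') + r 0 * (b * b') + r 1 * (c * c') + r 2 * (d * d') + r 3 * (e * e') := by
      intro a b c d e a' b' c' d' e'
      simp only [map_add, map_smul, eta_add_left, eta_add_right, eta_smul_left, eta_smul_right,
        hRt, hxt, hd, hS', h1]
      simp
      ring
    intro u v
    have h := key (eta t u) (eta (x 0) u)
      (eta (x 1) u) (eta (x 2) u) (eta (x 3) u) (eta t v) (eta (x 0) v) (eta (x 1) v)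
      (eta (x 2) v) (eta (x 3) v)
    rw [← hexp u, ← hexp v] at h
    exact h
  have q : (√2)⁻¹ * (√2)⁻¹ = (1 / 2 : ℝ) := by
    rw [← mul_inv, Real.mul_self_sqrt (by norm_num)]; norm_num
  set w : ℝ := (√2)⁻¹
  refine ⟨w • (x 0 + t), w • (x 0 - t), x 1, x 2, x 3, ?_, (r 0 + μ) / 2, (r 0 - μ) / 2, r 1, r 2,
    r 3, Or.inl ?_⟩
  · refine ⟨?_, ?_, ?_, ?_, ?_, ?_, ?_, ?_, ?_, ?_, ?_, ?_, ?_, ?_, ?_⟩ <;>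
      simp [eta_add_left, eta_add_right, eta_smul_left, eta_smul_right, eta_sub_left,
        eta_sub_right, ho, hS', hS'', h1]
    linear_combination 2 * q
  · intro u v
    rw [hB]
    simp only [eta_add_left, eta_smul_left, eta_sub_left]
    generalize eta t u = tu, eta t v = tv, eta (x 0) u = au, eta (x 0) v = av
    linear_combination (-(2 * (r 0 * (au * av)) - 2 * (μ * (tu * tv)))) * q

/-- Normal form relative to a null eigenvector `l`. -/
def NullData (R : V5 →ₗ[ℝ] V5) (l m x y z : V5) (k c r3 r4 r5 a3 a4 a5 : ℝ) : Prop :=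
  SemiNullPentad l m x y z ∧ ∀ u v : V5, eta (R u) v =
    k * (eta l u * eta m v + eta m u * eta l v) + c * (eta l u * eta l v) +
    r3 * (eta x u * eta x v) + r4 * (eta y u * eta y v) + r5 * (eta z u * eta z v) +
    a3 * (eta l u * eta x v + eta x u * eta l v) +
    a4 * (eta l u * eta y v + eta y u * eta l v) +
    a5 * (eta l u * eta z v + eta z u * eta l v)

theorem NullData.swap12 {R : V5 →ₗ[ℝ] V5} {l m x y z : V5} {k c r3 r4 r5 a3 a4 a5 : ℝ}
    (h : NullData R l m x y z k c r3 r4 r5 a3 a4 a5) :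
    NullData R l m y x z k c r4 r3 r5 a4 a3 a5 := by
  obtain ⟨⟨h1, h2, h3, h4, h5, h6, h7, h8, h9, h10, h11, h12, h13, h14, h15⟩, hB⟩ := h
  refine ⟨⟨h1, h3, h2, h4, h5, h6, h8, h7, h9, h11, h10, h12, ?_, h15, h14⟩, ?_⟩
  · rw [eta_comm, h13]
  · intro u v
    rw [hB]; ring

theorem NullData.swap23 {R : V5 →ₗ[ℝ] V5} {l m x y z : V5} {k c r3 r4 r5 a3 a4 a5 : ℝ}
    (h : NullData R l m x y z k c r3 r4 r5 a3 a4 a5) :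
    NullData R l m x z y k c r3 r5 r4 a3 a5 a4 := by
  obtain ⟨⟨h1, h2, h3, h4, h5, h6, h7, h8, h9, h10, h11, h12, h13, h14, h15⟩, hB⟩ := h
  refine ⟨⟨h1, h2, h4, h3, h5, h6, h7, h9, h8, h10, h12, h11, h14, h13, ?_⟩, ?_⟩
  · rw [eta_comm, h15]
  · intro u v
    rw [hB]; ring

theorem NullData.shift {R : V5 →ₗ[ℝ] V5} {l m x y z : V5} {k c r3 r4 r5 a3 a4 a5 : ℝ}
    (h : NullData R l m x y z k c r3 r4 r5 a3 a4 a5) (t : ℝ) :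
    NullData R l (m + t • x - (t ^ 2 / 2) • l) (x - t • l) y z k
      (c - k * t ^ 2 + r3 * t ^ 2 + 2 * a3 * t) r3 r4 r5 (a3 + (r3 - k) * t) a4 a5 := by
  obtain ⟨⟨h1, h2, h3, h4, h5, h6, h7, h8, h9, h10, h11, h12, h13, h14, h15⟩, hB⟩ := h
  refine ⟨⟨?_, ?_, ?_, ?_, ?_, ?_, ?_, ?_, ?_, ?_, ?_, ?_, ?_, ?_, ?_⟩, ?_⟩
  case refine_16 =>
    intro u v
    rw [hB]
    simp only [eta_add_left, eta_smul_left, eta_sub_left]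
    ring
  all_goals
    simp only [eta_add_left, eta_smul_left, eta_sub_left, eta_add_right, eta_smul_right,
      eta_sub_right, eta_comm m l, eta_comm x l, eta_comm x m,
      h1, h2, h3, h4, h5, h6, h7, h8, h9, h10, h11, h12, h13, h14, h15]
    try ring

theorem NullData.scale {R : V5 →ₗ[ℝ] V5} {l m x y z : V5} {k c r3 r4 r5 a3 a4 a5 : ℝ}
    (h : NullData R l m x y z k c r3 r4 r5 a3 a4 a5) (t : ℝ) (ht : t ≠ 0) :
    NullData R (t • l) (t⁻¹ • m) x y z k (c / t ^ 2) r3 r4 r5 (a3 / t) (a4 / t) (a5 / t) := by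
  obtain ⟨⟨h1, h2, h3, h4, h5, h6, h7, h8, h9, h10, h11, h12, h13, h14, h15⟩, hB⟩ := h
  refine ⟨⟨?_, h2, h3, h4, ?_, ?_, ?_, ?_, ?_, ?_, ?_, ?_, h13, h14, h15⟩, ?_⟩
  case refine_10 =>
    intro u v
    rw [hB]
    simp only [eta_smul_left]
    field_simp
  all_goals
    simp [eta_smul_left, eta_smul_right,
      h1, h5, h6, h7, h8, h9, h10, h11, h12, ht]

theorem NullData.rotate {R : V5 →ₗ[ℝ] V5} {l m x y z : V5} {k c r r5 a3 a4 a5 : ℝ}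
    (h : NullData R l m x y z k c r r r5 a3 a4 a5) (p q : ℝ) (hpq : p ^ 2 + q ^ 2 = 1) :
    NullData R l m (p • x + q • y) (p • y - q • x) z k c r r r5
      (p * a3 + q * a4) (p * a4 - q * a3) a5 := by
  obtain ⟨⟨h1, h2, h3, h4, h5, h6, h7, h8, h9, h10, h11, h12, h13, h14, h15⟩, hB⟩ := h
  refine ⟨⟨h1, ?_, ?_, h4, h5, h6, ?_, ?_, h9, ?_, ?_, h12, ?_, ?_, ?_⟩, ?_⟩
  case refine_10 =>
    intro u v
    rw [hB]
    simp only [eta_add_left, eta_smul_left, eta_sub_left]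
    linear_combination (-(r * (eta x u * eta x v) + r * (eta y u * eta y v) +
      a3 * (eta l u * eta x v + eta x u * eta l v) +
      a4 * (eta l u * eta y v + eta y u * eta l v))) * hpq
  all_goals
    simp only [eta_add_left, eta_smul_left, eta_sub_left, eta_add_right, eta_smul_right,
      eta_sub_right, eta_comm y x,
      h1, h2, h3, h4, h5, h6, h7, h8, h9, h10, h11, h12, h13, h14, h15]
    first | ring1 | linear_combination hpq

theorem NullData.fin1 {R : V5 →ₗ[ℝ] V5} {l m x y z : V5} {k c r3 r4 r5 a3 : ℝ}
    (h : NullData R l m x y z k c r3 r4 r5 a3 0 0) (h3 : a3 = 0 ∨ r3 = k) : HasForm R := by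
  by_cases ha : a3 = 0
  · subst ha
    by_cases hc : c = 0
    · subst hc
      refine ⟨l, m, x, y, z, h.1, k, 0, r3, r4, r5, Or.inl ?_⟩
      intro u v
      rw [h.2]; ring
    · have hs : √|c| ≠ 0 := (Real.sqrt_pos.mpr (abs_pos.mpr hc)).ne'
      have h' := h.scale _ hs
      rw [Real.sq_sqrt (abs_nonneg c)] at h'
      refine ⟨_, _, x, y, z, h'.1, k, 0, r3, r4, r5, Or.inr (Or.inl ⟨c / |c|, ?_, ?_⟩)⟩
      · rcases lt_or_gt_of_ne hc with hc' | hc'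
        · right
          rw [abs_of_neg hc']; field_simp
        · left
          rw [abs_of_pos hc']; field_simp
      · intro u v
        rw [h'.2]; ring
  · obtain rfl : r3 = k := h3.resolve_left ha
    have h' := (h.shift (-c / (2 * a3))).scale a3 ha
    refine ⟨_, _, _, y, z, h'.1, r3, 0, 0, r4, r5, Or.inr (Or.inr (Or.inl ?_))⟩
    intro u v
    rw [h'.2]
    have e1 : c - r3 * (-c / (2 * a3)) ^ 2 + r3 * (-c / (2 * a3)) ^ 2 +
        2 * a3 * (-c / (2 * a3)) = 0 := by field_simp; ring
    have e2 : (a3 + (r3 - r3) * (-c / (2 * a3))) / a3 = 1 := by field_simp; ring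
    rw [e1, e2]; ring

theorem NullData.rotate' {R : V5 →ₗ[ℝ] V5} {l m x y z : V5} {k c r r5 a3 a4 a5 : ℝ}
    (h : NullData R l m x y z k c r r r5 a3 a4 a5) (h3 : a3 ≠ 0) :
    ∃ x' y' a, NullData R l m x' y' z k c r r r5 a 0 a5 := by
  have hp : 0 < a3 ^ 2 + a4 ^ 2 := by positivity
  have hs : √(a3 ^ 2 + a4 ^ 2) ≠ 0 := (Real.sqrt_pos.mpr hp).ne'
  have hq : √(a3 ^ 2 + a4 ^ 2) ^ 2 = a3 ^ 2 + a4 ^ 2 := Real.sq_sqrt hp.le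
  have h' := h.rotate (a3 / √(a3 ^ 2 + a4 ^ 2)) (a4 / √(a3 ^ 2 + a4 ^ 2)) (by
    rw [div_pow, div_pow, hq]; field_simp)
  have e : a3 / √(a3 ^ 2 + a4 ^ 2) * a4 - a4 / √(a3 ^ 2 + a4 ^ 2) * a3 = 0 := by ring
  rw [e] at h'
  exact ⟨_, _, _, h'⟩

theorem NullData.fin2 {R : V5 →ₗ[ℝ] V5} {l m x y z : V5} {k c r3 r4 r5 a3 a4 : ℝ}
    (h : NullData R l m x y z k c r3 r4 r5 a3 a4 0) (h3 : a3 = 0 ∨ r3 = k)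
    (h4 : a4 = 0 ∨ r4 = k) : HasForm R := by
  by_cases ha : a4 = 0
  · subst ha
    exact h.fin1 h3
  by_cases hb : a3 = 0
  · subst hb
    exact h.swap12.fin1 h4
  obtain rfl := h3.resolve_left hb
  obtain rfl := h4.resolve_left ha
  obtain ⟨x', y', a, h'⟩ := h.rotate' hb
  exact h'.fin1 (Or.inr rfl)

theorem NullData.fin3 {R : V5 →ₗ[ℝ] V5} {l m x y z : V5} {k c r3 r4 r5 a3 a4 a5 : ℝ}
    (h : NullData R l m x y z k c r3 r4 r5 a3 a4 a5) (h3 : a3 = 0 ∨ r3 = k)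
    (h4 : a4 = 0 ∨ r4 = k) (h5 : a5 = 0 ∨ r5 = k) : HasForm R := by
  by_cases ha : a5 = 0
  · subst ha
    exact h.fin2 h3 h4
  by_cases hb : a4 = 0
  · subst hb
    exact h.swap23.fin2 h3 h5
  obtain rfl := h4.resolve_left hb
  obtain rfl := h5.resolve_left ha
  obtain ⟨x', y', a, h'⟩ := h.swap12.swap23.rotate' hb
  exact h'.swap23.fin2 (Or.inr rfl) h3

theorem NullData.kill {R : V5 →ₗ[ℝ] V5} {l m x y z : V5} {k c r3 r4 r5 a3 a4 a5 : ℝ}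
    (h : NullData R l m x y z k c r3 r4 r5 a3 a4 a5) :
    ∃ m' x' c' a, NullData R l m' x' y z k c' r3 r4 r5 a a4 a5 ∧ (a = 0 ∨ r3 = k) := by
  by_cases hr : r3 = k
  · exact ⟨_, _, _, _, h, Or.inr hr⟩
  · refine ⟨_, _, _, _, h.shift (a3 / (k - r3)), Or.inl ?_⟩
    have : k - r3 ≠ 0 := sub_ne_zero.mpr (Ne.symm hr)
    field_simp
    ring

theorem null_case (R : V5 →ₗ[ℝ] V5) (hR : ∀ u v : V5, eta (R u) v = eta u (R v))
    (l : V5) (k : ℝ) (hl0 : l ≠ 0) (hl : eta l l = 0) (hRl : R l = k • l) : HasForm R := by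
  have h0 : l 0 ≠ 0 := fun h => hl0 (zero_of_spatial l h hl.le)
  obtain ⟨m, hlm, hm⟩ : ∃ m : V5, eta l m = 1 ∧ eta m m = 0 := by
    refine ⟨(1 / (2 * l 0 ^ 2)) • (l - (2 * l 0) • Pi.single 0 1), ?_, ?_⟩
    · simp only [eta_smul_right, eta_sub_right, hl]
      simp [eta]
      field_simp
    · simp only [eta_smul_right, eta_sub_right, eta_smul_left, eta_sub_left, hl]
      simp [eta]
      right; ring
  obtain ⟨x, y, z, hP, hB⟩ := extend_pair R hR l m hlm hl hm
  have hd : NullData R l m x y z k (eta (R m) m) (eta (R x) x) (eta (R y) y) (eta (R z) z)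
      (eta (R m) x) (eta (R m) y) (eta (R m) z) := by
    refine ⟨hP, ?_⟩
    obtain ⟨h1, h2, h3, h4, h5, h6, h7, h8, h9, h10, h11, h12, h13, h14, h15⟩ := hP
    intro u v
    rw [hB u v]
    simp only [hRl, eta_smul_left, h1, h5, h7, h8, h9]
    ring
  obtain ⟨m1, x1, c1, a1, g1, e1⟩ := hd.kill
  obtain ⟨m2, x2, c2, a2, g2, e2⟩ := g1.swap12.kill
  obtain ⟨m3, x3, c3, a3, g3, e3⟩ := g2.swap23.swap12.kill
  exact g3.fin3 e3 e2 e1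

theorem complex_case (R : V5 →ₗ[ℝ] V5) (hR : ∀ u v : V5, eta (R u) v = eta u (R v))
    (u w : V5) (a b : ℝ) (hb : b ≠ 0) (hu0 : u ≠ 0) (hu : R u = a • u - b • w)
    (hw : R w = b • u + a • w) : HasForm R := by
  have hPw : eta w w = - eta u u := by
    have h := hR u w
    rw [hu, hw] at h
    simp only [eta_sub_left, eta_smul_left, eta_add_right, eta_smul_right] at h
    have : b * (eta w w + eta u u) = 0 := by linarith
    have := (mul_eq_zero.mp this).resolve_left hb
    linarith
  have hN : eta u u ^ 2 + eta u w ^ 2 ≠ 0 := by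
    intro h
    have hP : eta u u = 0 := by nlinarith [sq_nonneg (eta u u), sq_nonneg (eta u w)]
    have hQ : eta u w = 0 := by nlinarith [sq_nonneg (eta u u), sq_nonneg (eta u w)]
    obtain ⟨k, rfl⟩ := null_perp u w hu0 hP (by rw [hPw, hP, neg_zero]) hQ
    rw [map_smul, hu] at hw
    have h2 : (b * (1 + k ^ 2)) • u = 0 := by
      have : (b * (1 + k ^ 2)) • u = (b • u + a • k • u) - k • (a • u - b • k • u) := by module
      rw [this, hw, sub_self]
    have h3 := (smul_eq_zero.mp h2).resolve_right hu0
    have : (1 + k ^ 2) ≠ 0 := by positivity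
    exact (mul_ne_zero hb this) h3
  set P := eta u u with hP
  set Q := eta u w with hQ
  obtain ⟨s, hs⟩ := IsAlgClosed.exists_pow_nat_eq
    (⟨Q / (P ^ 2 + Q ^ 2), P / (P ^ 2 + Q ^ 2)⟩ : ℂ) (n := 2) (by norm_num)
  have e1 : s.re * s.re - s.im * s.im = Q / (P ^ 2 + Q ^ 2) := by
    have := congrArg Complex.re hs
    simpa [pow_two] using this
  have e2 : s.re * s.im + s.im * s.re = P / (P ^ 2 + Q ^ 2) := by
    have := congrArg Complex.im hs
    simpa [pow_two] using this
  generalize s.re = α, s.im = β at e1 e2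
  rw [eq_div_iff hN] at e1 e2
  have hwu : eta w u = Q := by rw [eta_comm]
  set l := α • u - β • w with hl
  set m := α • w + β • u with hm
  have f1 : eta l l = 0 := by
    simp only [hl, eta_sub_left, eta_sub_right, eta_smul_left, eta_smul_right, hPw, hwu, ← hP,
      ← hQ]
    apply mul_right_cancel₀ hN
    linear_combination P * e1 - Q * e2
  have f2 : eta m m = 0 := by
    simp only [hm, eta_add_left, eta_add_right, eta_smul_left, eta_smul_right, hPw, hwu, ← hP,
      ← hQ]
    apply mul_right_cancel₀ hN
    linear_combination - P * e1 + Q * e2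
  have f3 : eta l m = 1 := by
    simp only [hl, hm, eta_sub_left, eta_add_right, eta_smul_left, eta_smul_right, hPw, hwu, ← hP,
      ← hQ]
    apply mul_right_cancel₀ hN
    linear_combination Q * e1 + P * e2
  have f4 : eta m l = 1 := by rw [eta_comm, f3]
  have Rl : R l = a • l - b • m := by
    simp only [hl, hm, map_sub, map_smul, hu, hw]; module
  have Rm : R m = b • l + a • m := by
    simp only [hl, hm, map_add, map_smul, hu, hw]; module
  obtain ⟨x, y, z, hPe, hB⟩ := extend_pair R hR l m f3 f1 f2
  refine ⟨l, m, x, y, z, hPe, a, b, eta (R x) x, eta (R y) y, eta (R z) z,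
    Or.inr (Or.inr (Or.inr ⟨hb, ?_⟩))⟩
  obtain ⟨h1, h2, h3, h4, h5, h6, h7, h8, h9, h10, h11, h12, h13, h14, h15⟩ := hPe
  intro u' v'
  rw [hB u' v', Rl, Rm]
  clear_value l m
  simp only [eta_sub_left, eta_add_left, eta_smul_left, f1, f2, f3, f4, h7, h8, h9, h10, h11, h12]
  ring

theorem span_case (R : V5 →ₗ[ℝ] V5) (hR : ∀ u v : V5, eta (R u) v = eta u (R v))
    (hW : (⨆ μ : ℝ, Module.End.eigenspace R μ) = ⊤) :
    ∃ (t : V5) (μ : ℝ), eta t t < 0 ∧ R t = μ • t := by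
  by_contra hcon
  push Not at hcon
  have hmem : (Pi.single 0 1 : V5) ∈ ⨆ μ : ℝ, Module.End.eigenspace R μ := by
    rw [hW]; trivial
  obtain ⟨f, hf, hsum⟩ := (Submodule.mem_iSup_iff_exists_finsupp _ _).mp hmem
  have hE : ∀ μ, R (f μ) = μ • f μ := fun μ => Module.End.mem_eigenspace_iff.mp (hf μ)
  have horth : ∀ μ ν, μ ≠ ν → eta (f μ) (f ν) = 0 := by
    intro μ ν hne
    have h := hR (f μ) (f ν)
    rw [hE, hE, eta_smul_left, eta_smul_right] at h
    have : (μ - ν) * eta (f μ) (f ν) = 0 := by linarith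
    exact (mul_eq_zero.mp this).resolve_left (sub_ne_zero.mpr hne)
  have h1 : etaB (Pi.single 0 1 : V5) (Pi.single 0 1 : V5) = -1 := by
    rw [etaB_apply]; simp [eta]
  rw [← hsum, Finsupp.sum] at h1
  simp only [map_sum, LinearMap.sum_apply, etaB_apply] at h1
  have h2 : 0 ≤ ∑ x ∈ f.support, ∑ y ∈ f.support, eta (f y) (f x) := by
    refine Finset.sum_nonneg fun x _ => Finset.sum_nonneg fun y _ => ?_
    by_cases hxy : y = x
    · subst hxy
      by_contra hneg
      exact hcon (f y) y (not_le.mp hneg) (hE y)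
    · rw [horth y x hxy]
  linarith

theorem irred_vec {E : Type*} [AddCommGroup E] [Module ℝ E] [FiniteDimensional ℝ E]
    [Nontrivial E] (T : E →ₗ[ℝ] E) :
    ∃ (q : Polynomial ℝ) (v : E), Irreducible q ∧ q.Monic ∧ v ≠ 0 ∧ Polynomial.aeval T q v = 0 := by
  have hint : IsIntegral ℝ T := Algebra.IsIntegral.isIntegral T
  have hne := minpoly.ne_zero hint
  have hnu := minpoly.not_isUnit ℝ T
  obtain ⟨q, hq, hirr, hdvd⟩ := Polynomial.exists_monic_irreducible_factor _ hnu
  obtain ⟨s, hs⟩ := hdvd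
  have hs0 : s ≠ 0 := by
    rintro rfl
    rw [mul_zero] at hs
    exact hne hs
  have hsT : Polynomial.aeval T s ≠ 0 := by
    intro h
    have h1 := Polynomial.natDegree_le_of_dvd (minpoly.dvd ℝ T h) hs0
    rw [hs, Polynomial.natDegree_mul hirr.ne_zero hs0] at h1
    have := hirr.natDegree_pos
    omega
  obtain ⟨y, hy⟩ : ∃ y, Polynomial.aeval T s y ≠ 0 := by
    by_contra hcon
    push Not at hcon
    exact hsT (LinearMap.ext hcon)
  refine ⟨q, Polynomial.aeval T s y, hirr, hq, hy, ?_⟩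
  have h := minpoly.aeval ℝ T
  rw [hs, map_mul] at h
  exact congrArg (fun F : E →ₗ[ℝ] E => F y) h

theorem exists_plane {E : Type*} [AddCommGroup E] [Module ℝ E] [FiniteDimensional ℝ E]
    [Nontrivial E] (T : E →ₗ[ℝ] E) :
    (∃ (v : E) (μ : ℝ), v ≠ 0 ∧ T v = μ • v) ∨
    ∃ (u w : E) (a b : ℝ), b ≠ 0 ∧ u ≠ 0 ∧ T u = a • u - b • w ∧ T w = b • u + a • w := by
  obtain ⟨q, v, hirr, hm, hv, hq⟩ := irred_vec T
  have hdeg : q.natDegree ≤ 2 := hirr.natDegree_le_two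
  have hpos := hirr.natDegree_pos
  rcases (by omega : q.natDegree = 1 ∨ q.natDegree = 2) with h1 | h2
  · left
    refine ⟨v, -q.coeff 0, hv, ?_⟩
    have hc : q.coeff 1 = 1 := by rw [← h1]; exact hm
    rw [Polynomial.aeval_eq_sum_range, h1] at hq
    simp [Finset.sum_range_succ, hc] at hq
    rw [neg_smul]
    exact eq_neg_of_add_eq_zero_right hq
  · right
    have hc : q.coeff 2 = 1 := by rw [← h2]; exact hm
    have hroot : ∀ x : ℝ, q.eval x ≠ 0 := by
      intro x hx
      have := Polynomial.degree_eq_one_of_irreducible_of_root hirr hx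
      rw [Polynomial.degree_eq_natDegree hirr.ne_zero, h2] at this
      norm_num at this
    have hev : ∀ x : ℝ, q.eval x = q.coeff 0 + q.coeff 1 * x + x ^ 2 := by
      intro x
      rw [Polynomial.eval_eq_sum_range, h2]
      simp [Finset.sum_range_succ, hc]
    rw [Polynomial.aeval_eq_sum_range, h2] at hq
    simp [Finset.sum_range_succ, hc, pow_two] at hq
    generalize q.coeff 0 = γ at *
    generalize q.coeff 1 = β at *
    have hD : 0 < γ - β ^ 2 / 4 := by
      by_contra hneg
      push Not at hneg
      apply hroot (-β / 2 + √(β ^ 2 / 4 - γ))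
      rw [hev]
      have := Real.sq_sqrt (show 0 ≤ β ^ 2 / 4 - γ by linarith)
      linear_combination this
    have hb : √(γ - β ^ 2 / 4) ≠ 0 := (Real.sqrt_pos.mpr hD).ne'
    have hb2 : √(γ - β ^ 2 / 4) ^ 2 = γ - β ^ 2 / 4 := Real.sq_sqrt hD.le
    generalize √(γ - β ^ 2 / 4) = b at *
    refine ⟨v, b⁻¹ • ((-β / 2) • v - T v), -β / 2, b, hb, hv, ?_, ?_⟩
    · rw [smul_smul, mul_inv_cancel₀ hb]; module
    · have hTT : T (T v) = -(γ • v) - β • T v := by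
        have : T (T v) = (γ • v + β • T v + T (T v)) - γ • v - β • T v := by module
        rw [this, hq]; module
      have hγ : γ = b ^ 2 + β ^ 2 / 4 := by linarith
      rw [map_smul, map_sub, map_smul, hTT, hγ]
      have hbi : b • v = (b⁻¹ * b ^ 2) • v := by
        congr 1; field_simp
      rw [hbi]
      module

theorem exists_form (R : V5 →ₗ[ℝ] V5) (hR : ∀ u v : V5, eta (R u) v = eta u (R v)) :
    HasForm R := by
  by_cases hW : (⨆ μ : ℝ, Module.End.eigenspace R μ) = ⊤
  · obtain ⟨t, μ, ht, hRt⟩ := span_case R hR hW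
    exact timelike_case R hR t μ ht hRt
  set W : Submodule ℝ V5 := ⨆ μ : ℝ, Module.End.eigenspace R μ with hWdef
  have hWinv : ∀ w ∈ W, R w ∈ W := by
    intro w hw
    refine Submodule.iSup_induction (motive := fun w => R w ∈ W) _ hw ?_ ?_ ?_
    · intro μ x hx
      rw [Module.End.mem_eigenspace_iff.mp hx]
      exact W.smul_mem _ (Submodule.mem_iSup_of_mem μ hx)
    · simp
    · intro x y hx hy
      rw [map_add]
      exact W.add_mem hx hy
  let C : Submodule ℝ V5 := ⨅ w : W, LinearMap.ker (etaB (w : V5))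
  have hC : ∀ v, v ∈ C ↔ ∀ w ∈ W, eta w v = 0 := by
    intro v
    simp [C, Submodule.mem_iInf, etaB_apply]
  have hCinv : ∀ v ∈ C, R v ∈ C := by
    intro v hv
    rw [hC] at hv ⊢
    intro w hw
    rw [← hR]
    exact hv _ (hWinv w hw)
  have hCne : Nontrivial C := by
    obtain ⟨f, hf0, hf⟩ := Submodule.exists_le_ker_of_lt_top W (lt_top_iff_ne_top.mpr hW)
    have hrep : ∀ w : V5, f w = ∑ i, w i * f (Pi.single i 1) := by
      intro w
      conv_lhs => rw [← Finset.univ_sum_single w]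
      rw [map_sum]
      refine Finset.sum_congr rfl fun i _ => ?_
      rw [← smul_eq_mul, ← map_smul, ← Pi.single_smul]
      simp
    let v : V5 := fun i => if i = 0 then -f (Pi.single 0 1) else f (Pi.single i 1)
    have hv : ∀ w, eta w v = f w := by
      intro w
      rw [hrep]
      simp [eta, v, Fin.sum_univ_five]
    have hvC : v ∈ C := by
      rw [hC]
      intro w hw
      rw [hv]
      exact hf hw
    refine ⟨⟨v, hvC⟩, 0, ?_⟩
    intro h
    apply hf0
    have hv0 : v = 0 := congrArg Subtype.val h
    ext1
    apply LinearMap.ext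
    intro w
    simp only [LinearMap.comp_apply, LinearMap.zero_apply]
    rw [← hv, hv0]
    simp [eta]
  rcases exists_plane (R.restrict hCinv) with ⟨v, μ, hv, hTv⟩ | ⟨u, w, a, b, hb, hu, hTu, hTw⟩
  · have hRv : R v = μ • (v : V5) := congrArg Subtype.val hTv
    have hvW : (v : V5) ∈ W :=
      Submodule.mem_iSup_of_mem μ (Module.End.mem_eigenspace_iff.mpr hRv)
    exact null_case R hR v μ (by simpa using hv) ((hC v).mp v.2 v hvW) hRv
  · exact complex_case R hR u w a b hb (by simpa using hu) (congrArg Subtype.val hTu)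
      (congrArg Subtype.val hTw)

theorem excl13 {R : V5 →ₗ[ℝ] V5} {l m x y z : V5} {p1 p2 p3 p4 p5 : ℝ}
    (hP : SemiNullPentad l m x y z) (h1 : Form1 R l m x y z p1 p2 p3 p4 p5)
    (h3 : Form3 R l m x y z p1 p4 p5) : False := by
  obtain ⟨g1, g2, g3, g4, g5, g6, g7, g8, g9, g10, g11, g12, g13, g14, g15⟩ := hP
  have a := h1 m x
  have b := h3 m x
  simp only [eta_comm x m, eta_comm y m, eta_comm z m, eta_comm y x, eta_comm z x,
    g1, g2, g5, g6, g7, g8, g9, g10, g11, g12, g13, g14] at a b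
  linarith

theorem excl12 {R : V5 →ₗ[ℝ] V5} {l m x y z : V5} {p1 p2 p3 p4 p5 : ℝ}
    (hP : SemiNullPentad l m x y z) (h1 : Form1 R l m x y z p1 p2 p3 p4 p5)
    (h2 : Form2 R l m x y z p1 p3 p4 p5) : False := by
  obtain ⟨g1, g2, g3, g4, g5, g6, g7, g8, g9, g10, g11, g12, g13, g14, g15⟩ := hP
  obtain ⟨e, he, h2⟩ := h2
  have a := h1 l l
  have b := h2 l l
  have c := h1 m m
  have d := h2 m m
  simp only [eta_comm x m, eta_comm y m, eta_comm z m, eta_comm x l, eta_comm y l, eta_comm z l,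
    eta_comm m l, g1, g5, g6, g7, g8, g9, g10, g11, g12] at a b c d
  rcases he with rfl | rfl <;> linarith

theorem excl14 {R : V5 →ₗ[ℝ] V5} {l m x y z : V5} {p1 p2 p3 p4 p5 : ℝ}
    (hP : SemiNullPentad l m x y z) (h1 : Form1 R l m x y z p1 p2 p3 p4 p5)
    (h2 : Form4 R l m x y z p1 p2 p3 p4 p5) : False := by
  obtain ⟨g1, g2, g3, g4, g5, g6, g7, g8, g9, g10, g11, g12, g13, g14, g15⟩ := hP
  obtain ⟨he, h2⟩ := h2
  have a := h1 l l
  have b := h2 l l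
  simp only [eta_comm x l, eta_comm y l, eta_comm z l,
    eta_comm m l, g1, g5, g6, g7, g8, g9, g10, g11, g12] at a b
  apply he; linarith

theorem excl23 {R : V5 →ₗ[ℝ] V5} {l m x y z : V5} {p1 p3 p4 p5 : ℝ}
    (hP : SemiNullPentad l m x y z) (h1 : Form2 R l m x y z p1 p3 p4 p5)
    (h3 : Form3 R l m x y z p1 p4 p5) : False := by
  obtain ⟨g1, g2, g3, g4, g5, g6, g7, g8, g9, g10, g11, g12, g13, g14, g15⟩ := hP
  obtain ⟨e, he, h1⟩ := h1
  have a := h1 m x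
  have b := h3 m x
  simp only [eta_comm x m, eta_comm y m, eta_comm z m, eta_comm y x, eta_comm z x,
    g1, g2, g5, g6, g7, g8, g9, g10, g11, g12, g13, g14] at a b
  linarith

theorem excl24 {R : V5 →ₗ[ℝ] V5} {l m x y z : V5} {p1 p2 p3 p4 p5 : ℝ}
    (hP : SemiNullPentad l m x y z) (h1 : Form2 R l m x y z p1 p3 p4 p5)
    (h2 : Form4 R l m x y z p1 p2 p3 p4 p5) : False := by
  obtain ⟨g1, g2, g3, g4, g5, g6, g7, g8, g9, g10, g11, g12, g13, g14, g15⟩ := hP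
  obtain ⟨e, _, h1⟩ := h1
  obtain ⟨he, h2⟩ := h2
  have a := h1 l l
  have b := h2 l l
  simp only [eta_comm x l, eta_comm y l, eta_comm z l,
    eta_comm m l, g1, g5, g6, g7, g8, g9, g10, g11, g12] at a b
  apply he; linarith

theorem excl34 {R : V5 →ₗ[ℝ] V5} {l m x y z : V5} {p1 p2 p3 p4 p5 : ℝ}
    (hP : SemiNullPentad l m x y z) (h3 : Form3 R l m x y z p1 p4 p5)
    (h1 : Form4 R l m x y z p1 p2 p3 p4 p5) : False := by
  obtain ⟨g1, g2, g3, g4, g5, g6, g7, g8, g9, g10, g11, g12, g13, g14, g15⟩ := hP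
  have a := h1.2 m x
  have b := h3 m x
  simp only [eta_comm x m, eta_comm y m, eta_comm z m, eta_comm y x, eta_comm z x,
    g1, g2, g5, g6, g7, g8, g9, g10, g11, g12, g13, g14] at a b
  linarith

theorem canonical_forms_classification (R : (Fin 5 → ℝ) →ₗ[ℝ] (Fin 5 → ℝ))
    (hR : ∀ u v : Fin 5 → ℝ, eta (R u) v = eta u (R v)) :
    ∃ l m x y z : Fin 5 → ℝ, SemiNullPentad l m x y z ∧
      ∃ p1 p2 p3 p4 p5 : ℝ,
        (Form1 R l m x y z p1 p2 p3 p4 p5 ∧ ¬ Form2 R l m x y z p1 p3 p4 p5 ∧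
          ¬ Form3 R l m x y z p1 p4 p5 ∧ ¬ Form4 R l m x y z p1 p2 p3 p4 p5) ∨
        (¬ Form1 R l m x y z p1 p2 p3 p4 p5 ∧ Form2 R l m x y z p1 p3 p4 p5 ∧
          ¬ Form3 R l m x y z p1 p4 p5 ∧ ¬ Form4 R l m x y z p1 p2 p3 p4 p5) ∨
        (¬ Form1 R l m x y z p1 p2 p3 p4 p5 ∧ ¬ Form2 R l m x y z p1 p3 p4 p5 ∧
          Form3 R l m x y z p1 p4 p5 ∧ ¬ Form4 R l m x y z p1 p2 p3 p4 p5) ∨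
        (¬ Form1 R l m x y z p1 p2 p3 p4 p5 ∧ ¬ Form2 R l m x y z p1 p3 p4 p5 ∧
          ¬ Form3 R l m x y z p1 p4 p5 ∧ Form4 R l m x y z p1 p2 p3 p4 p5) := by
  obtain ⟨l, m, x, y, z, hP, p1, p2, p3, p4, p5, h⟩ := exists_form R hR
  refine ⟨l, m, x, y, z, hP, p1, p2, p3, p4, p5, ?_⟩
  rcases h with h | h | h | h
  · exact Or.inl ⟨h, excl12 hP h, excl13 hP h, excl14 hP h⟩
  · exact Or.inr (Or.inl ⟨fun g => excl12 hP g h, h, excl23 hP h, excl24 hP h⟩)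
  · exact Or.inr (Or.inr (Or.inl ⟨fun g => excl13 hP g h, fun g => excl23 hP g h, h,
      excl34 hP h⟩))
  · exact Or.inr (Or.inr (Or.inr ⟨fun g => excl14 hP g h, fun g => excl24 hP g h,
      fun g => excl34 hP g h, h⟩))
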